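/- arXiv:2207.09213 — 4 statements merged into one kernel-verified Lean document; each statement's English description precedes it below -/
import Mathlib

section
/- Let D be a division ring equipped with a ℚ-algebra structure. Let f ∈ D be an element that does not lie in the center of D and whose square is a rational multiple of the identity, i.e. f·f = c·1 for some c ∈ ℚ. Then there exists a nonzero element d ∈ D such that f·d = −(d·f). -/
/-- Let `D` be a division ring equipped with a `ℚ`-algebra structure. Let `f ∈ D` be an
element that does not lie in the center of `D` and whose square is a rational multiple of
the identity, i.e. `f * f = c • 1` for some `c ∈ ℚ`. Then there exists a nonzero `d ∈ D`
such that `f * d = -(d * f)`. -/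
theorem stmt0 (D : Type*) [DivisionRing D] [Algebra ℚ D]
    (f : D) (hf : f ∉ Subring.center D)
    (c : ℚ) (hc : f * f = algebraMap ℚ D c) :
    ∃ d : D, d ≠ 0 ∧ f * d = -(d * f) := by
  obtain ⟨a, ha⟩ : ∃ a : D, a * f ≠ f * a := by
    simpa [Subring.mem_center_iff] using hf
  have hcomm : f * f * a = a * (f * f) := by
    rw [hc]
    exact Algebra.commutes c a
  refine ⟨f * a - a * f, sub_ne_zero.mpr ha.symm, ?_⟩
  rw [mul_sub, sub_mul, ← mul_assoc, hcomm]
  simp only [mul_assoc, neg_sub]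
end

section
/- Let D be a division ring which is a ℚ-algebra with dim_ℚ D = 4 and whose center consists exactly of the rational multiples of the identity. Let f ∈ D be an element not of the form q·1 with q ∈ ℚ, and suppose f·f = c·1 for some c ∈ ℚ. Then there exist d ∈ D and a nonzero b ∈ ℚ such that d·d = b·1, f·d = −(d·f), and the four elements (1, f, d, f·d) form a basis of D as a ℚ-vector space. -/
/-- If `f` is not rational, then `1` and `f` are linearly independent over `ℚ`. -/
lemma eq_zero_and_eq_zero_of_algebraMap_add_mul {D : Type*} [DivisionRing D] [Algebra ℚ D]
    {f : D} (hf : ∀ q : ℚ, f ≠ algebraMap ℚ D q) {a b : ℚ}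
    (h : algebraMap ℚ D a + algebraMap ℚ D b * f = 0) : a = 0 ∧ b = 0 := by
  have hb : b = 0 := by
    by_contra hb
    apply hf (b⁻¹ * -a)
    rw [map_mul, map_neg, ← eq_neg_of_add_eq_zero_right h, ← mul_assoc, ← map_mul,
      inv_mul_cancel₀ hb, map_one, one_mul]
  subst hb
  rw [map_zero, zero_mul, add_zero, map_eq_zero] at h
  exact ⟨h, rfl⟩

/-- If `f` is not rational and `d ≠ 0` anticommutes with `f`, then `1, f, d, f * d` are linearly
independent over `ℚ`. -/
lemma linearIndependent_of_anticommute {D : Type*} [DivisionRing D] [Algebra ℚ D]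
    {f d : D} (hf : ∀ q : ℚ, f ≠ algebraMap ℚ D q) (hd : d ≠ 0) (hfd : f * d = -(d * f)) :
    LinearIndependent ℚ ![(1 : D), f, d, f * d] := by
  have hf0 : f ≠ 0 := by simpa using hf 0
  rw [Fintype.linearIndependent_iff]
  intro g hg
  simp only [Fin.sum_univ_four, Matrix.cons_val, Algebra.smul_def, mul_one] at hg
  set u : D := algebraMap ℚ D (g 0) + algebraMap ℚ D (g 1) * f with hu
  set v : D := algebraMap ℚ D (g 2) + algebraMap ℚ D (g 3) * f with hv
  have huv : u + v * d = 0 := by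
    rw [← hg, hu, hv]
    noncomm_ring
  have hfu : f * u = u * f := by
    rw [hu, mul_add, add_mul, ← mul_assoc, Algebra.commutes, Algebra.commutes]
  have hfv : f * v = v * f := by
    rw [hv, mul_add, add_mul, ← mul_assoc, Algebra.commutes, Algebra.commutes]
  have hconj : (u - v * d) * f = 0 := by
    calc (u - v * d) * f = u * f + v * -(d * f) := by noncomm_ring
      _ = f * u + f * v * d := by rw [← hfd, ← hfu, hfv, mul_assoc]
      _ = f * (u + v * d) := by noncomm_ring
      _ = 0 := by rw [huv, mul_zero]
  have hsub : u - v * d = 0 := (mul_eq_zero.mp hconj).resolve_right hf0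
  have hu0 : u = 0 := by
    have : CharZero D := algebraRat.charZero D
    have h2 : u + u = 0 := by
      calc u + u = (u + v * d) + (u - v * d) := by abel
        _ = 0 := by rw [huv, hsub, add_zero]
    exact add_self_eq_zero.mp h2
  have hv0 : v = 0 := by
    rw [hu0, zero_add] at huv
    exact (mul_eq_zero.mp huv).resolve_right hd
  obtain ⟨h0, h1⟩ := eq_zero_and_eq_zero_of_algebraMap_add_mul hf hu0
  obtain ⟨h2, h3⟩ := eq_zero_and_eq_zero_of_algebraMap_add_mul hf hv0
  intro i
  fin_cases i <;> assumption

/-- Let `D` be a division ring which is a `ℚ`-algebra with `dim_ℚ D = 4` and whose center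
consists exactly of the rational multiples of the identity. Let `f ∈ D` be an element not of
the form `q • 1` with `q ∈ ℚ`, and suppose `f * f = c • 1` for some `c ∈ ℚ`. Then there exist
`d ∈ D` and a nonzero `b ∈ ℚ` such that `d * d = b • 1`, `f * d = -(d * f)`, and
`(1, f, d, f*d)` is a basis of `D` as a `ℚ`-vector space. -/
theorem stmt1 (D : Type*) [DivisionRing D] [Algebra ℚ D]
    (hdim : Module.finrank ℚ D = 4)
    (hcenter : ∀ x : D, x ∈ Subring.center D ↔ ∃ q : ℚ, x = algebraMap ℚ D q)
    (f : D) (hf : ∀ q : ℚ, f ≠ algebraMap ℚ D q)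
    (c : ℚ) (hc : f * f = algebraMap ℚ D c) :
    ∃ (d : D) (b : ℚ), b ≠ 0 ∧ d * d = algebraMap ℚ D b ∧ f * d = -(d * f) ∧
      LinearIndependent ℚ ![(1 : D), f, d, f * d] ∧
      Submodule.span ℚ {(1 : D), f, d, f * d} = ⊤ := by
  obtain ⟨x, hx⟩ : ∃ x : D, x * f ≠ f * x := by
    by_contra! h
    obtain ⟨q, hq⟩ := (hcenter f).mp (Subring.mem_center_iff.mpr h)
    exact hf q hq
  obtain ⟨d, hd⟩ : ∃ d, d = f * x - x * f := ⟨_, rfl⟩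
  have hd0 : d ≠ 0 := hd ▸ sub_ne_zero.mpr hx.symm
  have hfd : f * d = -(d * f) := by
    have hcx : f * f * x = x * (f * f) := by rw [hc, Algebra.commutes]
    calc f * d = f * f * x - f * x * f := by rw [hd]; noncomm_ring
      _ = x * (f * f) - f * x * f := by rw [hcx]
      _ = -(d * f) := by rw [hd]; noncomm_ring
  have hli := linearIndependent_of_anticommute hf hd0 hfd
  have hspan : Submodule.span ℚ {(1 : D), f, d, f * d} = ⊤ := by
    have h := hli.span_eq_top_of_card_eq_finrank (by simp [hdim])
    rwa [Matrix.range_cons, Matrix.range_cons, Matrix.range_cons, Matrix.range_cons,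
      Matrix.range_empty, Set.union_empty, Set.singleton_union, Set.singleton_union,
      Set.singleton_union] at h
  have hcomm_f : f * (d * d) = d * d * f := by
    rw [← mul_assoc, hfd, neg_mul, mul_assoc, hfd, mul_neg, neg_neg, mul_assoc]
  have hcentral : d * d ∈ Subring.center D := by
    rw [Subring.mem_center_iff]
    intro y
    have hy : y ∈ Submodule.span ℚ {(1 : D), f, d, f * d} := hspan ▸ Submodule.mem_top
    induction hy using Submodule.span_induction with
    | mem y hy =>
      rcases hy with rfl | rfl | rfl | rfl
      · rw [one_mul, mul_one]
      · exact hcomm_f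
      · rw [mul_assoc]
      · rw [← mul_assoc (d * d), ← hcomm_f]
        simp only [mul_assoc]
    | zero => rw [zero_mul, mul_zero]
    | add y z _ _ hy hz => rw [add_mul, mul_add, hy, hz]
    | smul a y _ hy => rw [smul_mul_assoc, mul_smul_comm, hy]
  obtain ⟨b, hb⟩ := (hcenter (d * d)).mp hcentral
  refine ⟨d, b, ?_, hb, hfd, hli, hspan⟩
  rintro rfl
  rw [map_zero] at hb
  exact mul_ne_zero hd0 hd0 hb
end

section
/- Let p be a prime and let A be a 2×2 matrix over the ring ℤ_p of p-adic integers such that the reduction of A modulo p is not a scalar multiple of the identity matrix over ℤ/p. Then there exists a vector v ∈ ℤ_p² such that the 2×2 matrix P whose columns are v and A·v is invertible over ℤ_p, and P⁻¹·A·P equals the companion matrix [[0, −det A],[1, trace A]] of the characteristic polynomial of A. -/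
namespace Matrix

variable {R : Type*} [CommRing R]

/-- The determinant of the matrix with columns `v` and `A *ᵥ v`, as a quadratic form in `v`. -/
theorem det_of_vec_mulVec_fin_two (A : Matrix (Fin 2) (Fin 2) R) (v : Fin 2 → R) :
    (Matrix.of fun i j => ![v, A.mulVec v] j i).det =
      A 1 0 * v 0 ^ 2 + (A 1 1 - A 0 0) * (v 0 * v 1) - A 0 1 * v 1 ^ 2 := by
  simp [det_fin_two]
  ring

/-- By Cayley–Hamilton, a cyclic vector conjugates a `2 × 2` matrix to its companion form. -/
theorem inv_mul_mul_of_vec_mulVec_fin_two (A : Matrix (Fin 2) (Fin 2) R) (v : Fin 2 → R)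
    (h : IsUnit (Matrix.of fun i j => ![v, A.mulVec v] j i)) :
    (Matrix.of fun i j => ![v, A.mulVec v] j i)⁻¹ * A *
        (Matrix.of fun i j => ![v, A.mulVec v] j i) = !![0, -A.det; 1, A.trace] := by
  have key : A * (Matrix.of fun i j => ![v, A.mulVec v] j i) =
      (Matrix.of fun i j => ![v, A.mulVec v] j i) * !![0, -A.det; 1, A.trace] := by
    ext i j
    fin_cases i <;> fin_cases j <;>
      simp [mul_apply, det_fin_two, trace_fin_two, Fin.sum_univ_two] <;> ring
  rw [Matrix.mul_assoc, key,
    nonsing_inv_mul_cancel_left _ _ ((isUnit_iff_isUnit_det _).1 h)]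

/-- Over a local ring, a `2 × 2` matrix that is not scalar modulo the maximal ideal has a
cyclic vector. -/
theorem exists_isUnit_of_vec_mulVec_fin_two [IsLocalRing R] (A : Matrix (Fin 2) (Fin 2) R)
    (hA : ¬ (A 1 0 ∈ IsLocalRing.maximalIdeal R ∧ A 0 1 ∈ IsLocalRing.maximalIdeal R ∧
      A 1 1 - A 0 0 ∈ IsLocalRing.maximalIdeal R)) :
    ∃ v : Fin 2 → R, IsUnit (Matrix.of fun i j => ![v, A.mulVec v] j i) := by
  by_contra! h
  have hv (v : Fin 2 → R) : A 1 0 * v 0 ^ 2 + (A 1 1 - A 0 0) * (v 0 * v 1) - A 0 1 * v 1 ^ 2 ∈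
      IsLocalRing.maximalIdeal R := by
    rw [← det_of_vec_mulVec_fin_two, IsLocalRing.mem_maximalIdeal, mem_nonunits_iff,
      ← isUnit_iff_isUnit_det]
    exact h v
  have h₁ : A 1 0 ∈ IsLocalRing.maximalIdeal R := by simpa using hv ![1, 0]
  have h₂ : A 0 1 ∈ IsLocalRing.maximalIdeal R := by simpa using hv ![0, 1]
  refine hA ⟨h₁, h₂, ?_⟩
  have h₃ := add_mem (sub_mem (hv ![1, 1]) h₁) h₂
  convert h₃ using 1
  simp only [cons_val_zero, cons_val_one]
  ring

end Matrix

/-- Let `p` be a prime and `A` a `2 × 2` matrix over `ℤ_[p]` whose reduction modulo `p` is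
not a scalar multiple of the identity matrix over `ZMod p`. Then there is a vector
`v ∈ ℤ_[p]²` such that the matrix `P` with columns `v` and `A *ᵥ v` is invertible over
`ℤ_[p]` and `P⁻¹ * A * P` is the companion matrix `[[0, -det A], [1, trace A]]` of the
characteristic polynomial of `A`. -/
theorem stmt3 (p : ℕ) [Fact p.Prime] (A : Matrix (Fin 2) (Fin 2) ℤ_[p])
    (hA : ¬ ∃ c : ZMod p,
      A.map (PadicInt.toZMod) = c • (1 : Matrix (Fin 2) (Fin 2) (ZMod p))) :
    ∃ v : Fin 2 → ℤ_[p],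
      IsUnit (Matrix.of fun i j => ![v, A.mulVec v] j i) ∧
      (Matrix.of fun i j => ![v, A.mulVec v] j i)⁻¹ * A *
          (Matrix.of fun i j => ![v, A.mulVec v] j i) =
        !![0, -A.det; 1, A.trace] := by
  obtain ⟨v, hv⟩ := A.exists_isUnit_of_vec_mulVec_fin_two fun ⟨h₁, h₂, h₃⟩ => hA <| by
    rw [← PadicInt.ker_toZMod, RingHom.mem_ker] at h₁ h₂ h₃
    rw [map_sub, sub_eq_zero] at h₃
    refine ⟨PadicInt.toZMod (A 0 0), ?_⟩
    ext i j
    fin_cases i <;> fin_cases j <;> simp [h₁, h₂, h₃]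
  exact ⟨v, hv, A.inv_mul_mul_of_vec_mulVec_fin_two v hv⟩
end

section
/- Let K be a field extension of ℚ of degree 2. Let W be a ℚ-subspace of the space M₂(K) of 2×2 matrices over K (regarded as a ℚ-vector space by restriction of scalars) with dim_ℚ W = 4 and containing the identity matrix. Let L ⊆ K² be a one-dimensional K-subspace. Then there exists a matrix M ∈ W such that M maps L into L and M is not a rational multiple of the identity matrix. -/
/-- A vector of `K²` whose determinant against a nonzero vector `v` vanishes is a multiple
of `v`. -/
theorem exists_smul_eq_of_det_eq_zero {K : Type*} [Field K] {v w : Fin 2 → K} (hv : v ≠ 0)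
    (h : v 0 * w 1 - v 1 * w 0 = 0) : ∃ c : K, c • v = w := by
  by_cases h0 : v 0 = 0
  · have hv1 : v 1 ≠ 0 := by
      intro hv1
      apply hv
      ext i
      fin_cases i <;> simp [h0, hv1]
    have hw0 : w 0 = 0 := by simpa [h0, hv1] using h
    refine ⟨w 1 / v 1, ?_⟩
    ext i
    fin_cases i <;> simp [h0, hw0, hv1]
  · refine ⟨w 0 / v 0, ?_⟩
    ext i
    fin_cases i
    · simp [h0]
    · simp only [Fin.mk_one, Pi.smul_apply, smul_eq_mul]
      field_simp
      linear_combination -h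

/-- A `k`-subspace of `M₂(K)` of dimension greater than `[K : k] + 1` that contains the identity
has a non-scalar (over `k`) element stabilising a given line of `K²`. -/
theorem exists_mem_stabilizing_line_ne_smul_one {k K : Type*} [Field k] [Field K] [Algebra k K]
    [FiniteDimensional k K] (W : Submodule k (Matrix (Fin 2) (Fin 2) K))
    (hW : Module.finrank k K + 1 < Module.finrank k W)
    (h1 : (1 : Matrix (Fin 2) (Fin 2) K) ∈ W)
    (L : Submodule K (Fin 2 → K)) (hL : Module.finrank K L = 1) :
    ∃ M ∈ W, (∀ x ∈ L, M.mulVec x ∈ L) ∧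
      ∀ q : k, M ≠ q • (1 : Matrix (Fin 2) (Fin 2) K) := by
  obtain ⟨v, hv, hspan⟩ := finrank_eq_one_iff'.mp hL
  have hv0 : (v : Fin 2 → K) ≠ 0 := fun h => hv (Subtype.ext h)
  obtain ⟨φ, hφ⟩ : ∃ φ : Matrix (Fin 2) (Fin 2) K →ₗ[k] K,
      ∀ M, φ M = v.1 0 * M.mulVec v.1 1 - v.1 1 * M.mulVec v.1 0 :=
    ⟨{  toFun := fun M => v.1 0 * M.mulVec v.1 1 - v.1 1 * M.mulVec v.1 0
        map_add' := fun M N => by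
          simp only [Matrix.add_mulVec, Pi.add_apply]
          ring
        map_smul' := fun q M => by
          simp only [Matrix.smul_mulVec, Pi.smul_apply, mul_smul_comm, smul_sub,
            RingHom.id_apply] }, fun _ => rfl⟩
  have : FiniteDimensional k W := Module.finite_of_finrank_pos (by omega)
  have hker : 1 < Module.finrank k (LinearMap.ker (φ.domRestrict W)) := by
    have hrank := (φ.domRestrict W).finrank_range_add_finrank_ker
    have hrange := Submodule.finrank_le (LinearMap.range (φ.domRestrict W))
    omega
  by_contra! hscalar
  have hle : LinearMap.ker (φ.domRestrict W) ≤ Submodule.span k {(⟨1, h1⟩ : W)} := by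
    rintro ⟨M, hMW⟩ hM
    obtain ⟨c, hc⟩ := exists_smul_eq_of_det_eq_zero hv0 ((hφ M).symm.trans hM)
    obtain ⟨q, hq⟩ := hscalar M hMW fun x hx => by
      obtain ⟨a, ha⟩ := hspan ⟨x, hx⟩
      have hax : a • (v : Fin 2 → K) = x := congrArg Subtype.val ha
      rw [← hax, Matrix.mulVec_smul, ← hc]
      exact L.smul_mem _ (L.smul_mem _ v.2)
    exact Submodule.mem_span_singleton.mpr ⟨q, Subtype.ext hq.symm⟩
  have hfinrank := Submodule.finrank_mono hle
  have hspan_one := finrank_span_le_card (R := k) {(⟨1, h1⟩ : W)}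
  rw [Set.toFinset_singleton, Finset.card_singleton] at hspan_one
  omega

/-- Let `K` be a quadratic field extension of `ℚ`. Let `W` be a `ℚ`-subspace of the space of
`2 × 2` matrices over `K` with `dim_ℚ W = 4`, containing the identity matrix. Let `L ⊆ K²`
be a one-dimensional `K`-subspace. Then there exists `M ∈ W` mapping `L` into `L` which is
not a rational multiple of the identity matrix. -/
theorem stmt4 (K : Type*) [Field K] [Algebra ℚ K] (hK : Module.finrank ℚ K = 2)
    (W : Submodule ℚ (Matrix (Fin 2) (Fin 2) K)) (hW : Module.finrank ℚ W = 4)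
    (h1 : (1 : Matrix (Fin 2) (Fin 2) K) ∈ W)
    (L : Submodule K (Fin 2 → K)) (hL : Module.finrank K L = 1) :
    ∃ M ∈ W, (∀ x ∈ L, M.mulVec x ∈ L) ∧
      ∀ q : ℚ, M ≠ q • (1 : Matrix (Fin 2) (Fin 2) K) := by
  have : FiniteDimensional ℚ K := Module.finite_of_finrank_pos (by omega)
  exact exists_mem_stabilizing_line_ne_smul_one W (by omega) h1 L hL
end
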